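/- The set of unit rectangles in Π equals Φ([0, 2π]) ∪ (−Φ)([0, 2π]), the union of the images of Φ and −Φ over the interval [0, 2π]. -/

import Mathlib

noncomputable section

open Real Set

/-- Membership predicate for conformally inscribed parallelograms.
Coordinates of `P : Fin 9 → ℝ`:
`0 = x_A, 1 = y_A, 2 = x_B, 3 = y_B, 4 = x_C, 5 = y_C, 6 = x_D, 7 = y_D, 8 = w`.
The vertex `(x_L, y_L)` lies on the line `L(w)` for `L ∈ {A,B,C,D}` and the
midpoints of the two diagonals coincide. -/
def IsCIP (mA mB mC mD bA : ℝ) (P : Fin 9 → ℝ) : Prop :=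
  P 1 = mA * P 0 + bA * P 8 ∧
  P 3 = mB * P 2 + P 8 ∧
  P 5 = mC * P 4 ∧
  P 7 = mD * P 6 ∧
  P 0 + P 4 = P 2 + P 6 ∧
  P 1 + P 5 = P 3 + P 7

/-- `Π`, the set of conformally inscribed parallelograms. -/
def CIP (mA mB mC mD bA : ℝ) : Set (Fin 9 → ℝ) := {P | IsCIP mA mB mC mD bA P}

/-- The `AC` diagonal vector of a parallelogram. -/
def vAC (P : Fin 9 → ℝ) : ℝ × ℝ := (P 0 - P 4, P 1 - P 5)

/-- The `BD` diagonal vector of a parallelogram. -/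
def vBD (P : Fin 9 → ℝ) : ℝ × ℝ := (P 2 - P 6, P 3 - P 7)

/-- The `AB` side vector of a parallelogram. -/
def vAB (P : Fin 9 → ℝ) : ℝ × ℝ := (P 0 - P 2, P 1 - P 3)

/-- The `BC` side vector of a parallelogram. -/
def vBC (P : Fin 9 → ℝ) : ℝ × ℝ := (P 2 - P 4, P 3 - P 5)

/-- Dot product in `ℝ²`. -/
def dot2 (a b : ℝ × ℝ) : ℝ := a.1 * b.1 + a.2 * b.2

/-- The inner product `⟨P, Q⟩ = P_AC · Q_AC + P_BD · Q_BD` on `Π`. -/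
def pinner (P Q : Fin 9 → ℝ) : ℝ := dot2 (vAC P) (vAC Q) + dot2 (vBD P) (vBD Q)

/-- The parametrization `Φ` of a conformal solution. -/
def Phi (U V T : Fin 9 → ℝ) (lam mu : ℝ) (θ : ℝ) : Fin 9 → ℝ :=
  (Real.sqrt (lam - mu * Real.cos θ ^ 2) / Real.sqrt (2 * lam)) • U +
    (Real.sin θ / Real.sqrt 2) • V + (Real.cos θ / Real.sqrt (2 * lam)) • T

theorem combination_mem_CIP {mA mB mC mD bA : ℝ} {U V T : Fin 9 → ℝ}
    (hU : U ∈ CIP mA mB mC mD bA) (hV : V ∈ CIP mA mB mC mD bA)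
    (hT : T ∈ CIP mA mB mC mD bA) (u v t : ℝ) :
    u • U + v • V + t • T ∈ CIP mA mB mC mD bA := by
  obtain ⟨hU1, hU2, hU3, hU4, hU5, hU6⟩ := hU
  obtain ⟨hV1, hV2, hV3, hV4, hV5, hV6⟩ := hV
  obtain ⟨hT1, hT2, hT3, hT4, hT5, hT6⟩ := hT
  refine ⟨?_, ?_, ?_, ?_, ?_, ?_⟩ <;> simp only [Pi.add_apply, Pi.smul_apply, smul_eq_mul]
  · linear_combination u * hU1 + v * hV1 + t * hT1
  · linear_combination u * hU2 + v * hV2 + t * hT2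
  · linear_combination u * hU3 + v * hV3 + t * hT3
  · linear_combination u * hU4 + v * hV4 + t * hT4
  · linear_combination u * hU5 + v * hV5 + t * hT5
  · linear_combination u * hU6 + v * hV6 + t * hT6

/-- Squared length of the `AC` diagonal in coordinates with respect to `U`, `V`, `T`. -/
theorem dot2_vAC_combination {U V T : Fin 9 → ℝ} (hVV : pinner V V = 1)
    (hVT : pinner V T = 0) (hUAC : vAC U = (0, 0)) (hVBD : vBD V = (0, 0)) (u v t : ℝ) :
    dot2 (vAC (u • U + v • V + t • T)) (vAC (u • U + v • V + t • T)) =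
      v ^ 2 + t ^ 2 * dot2 (vAC T) (vAC T) := by
  simp only [pinner, hVBD] at hVV hVT
  simp only [vAC, Prod.mk.injEq] at hUAC
  obtain ⟨h1, h2⟩ := hUAC
  rw [sub_eq_zero] at h1 h2
  simp only [dot2, vAC, Pi.add_apply, Pi.smul_apply, smul_eq_mul] at *
  rw [h1, h2]
  linear_combination v ^ 2 * hVV + 2 * v * t * hVT

/-- Squared length of the `BD` diagonal in coordinates with respect to `U`, `V`, `T`. -/
theorem dot2_vBD_combination {U V T : Fin 9 → ℝ} (hUU : pinner U U = 1)
    (hUT : pinner U T = 0) (hUAC : vAC U = (0, 0)) (hVBD : vBD V = (0, 0)) (u v t : ℝ) :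
    dot2 (vBD (u • U + v • V + t • T)) (vBD (u • U + v • V + t • T)) =
      u ^ 2 + t ^ 2 * dot2 (vBD T) (vBD T) := by
  simp only [pinner, hUAC] at hUU hUT
  simp only [vBD, Prod.mk.injEq] at hVBD
  obtain ⟨h1, h2⟩ := hVBD
  rw [sub_eq_zero] at h1 h2
  simp only [dot2, vBD, Pi.add_apply, Pi.smul_apply, smul_eq_mul] at *
  rw [h1, h2]
  linear_combination u ^ 2 * hUU + 2 * u * t * hUT

theorem exists_mem_Icc_cos_eq_sin_eq {c s : ℝ} (h : c ^ 2 + s ^ 2 = 1) :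
    ∃ θ ∈ Set.Icc 0 (2 * π), Real.cos θ = c ∧ Real.sin θ = s := by
  have hc : Real.cos (Real.arccos c) = c := Real.cos_arccos (by nlinarith) (by nlinarith)
  have hs : Real.sin (Real.arccos c) = |s| := by
    rw [Real.sin_arccos, ← Real.sqrt_sq_eq_abs]
    congr 1
    linarith
  have h0 := Real.arccos_nonneg c
  have hpi := Real.arccos_le_pi c
  rcases le_total 0 s with hs0 | hs0
  · exact ⟨Real.arccos c, ⟨h0, by linarith⟩, hc, by rw [hs, abs_of_nonneg hs0]⟩
  · refine ⟨2 * π - Real.arccos c, ⟨by linarith, by linarith⟩, ?_, ?_⟩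
    · rw [Real.cos_two_pi_sub, hc]
    · rw [Real.sin_two_pi_sub, hs, abs_of_nonpos hs0, neg_neg]

/-- Nonnegative `U`-coordinate solutions of the unit rectangle equations lie on `Phi`. -/
theorem combination_mem_Phi_image (U V T : Fin 9 → ℝ) {lam mu u v t : ℝ} (hlam : 0 < lam)
    (hu : 0 ≤ u) (hAC : v ^ 2 + t ^ 2 * lam = 1 / 2) (hBD : u ^ 2 + t ^ 2 * mu = 1 / 2) :
    u • U + v • V + t • T ∈ Phi U V T lam mu '' Set.Icc 0 (2 * π) := by
  have h2 : √2 ≠ 0 := by positivity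
  have h2l : √(2 * lam) ≠ 0 := by positivity
  have h2s : √2 ^ 2 = 2 := Real.sq_sqrt (by norm_num)
  have h2ls : √(2 * lam) ^ 2 = 2 * lam := Real.sq_sqrt (by positivity)
  obtain ⟨θ, hθ, hcos, hsin⟩ := exists_mem_Icc_cos_eq_sin_eq
    (c := √(2 * lam) * t) (s := √2 * v) (by rw [mul_pow, mul_pow, h2s, h2ls]; linarith)
  refine ⟨θ, hθ, ?_⟩
  have hroot : √(lam - mu * (√(2 * lam) * t) ^ 2) = √(2 * lam) * u := by
    rw [← Real.sqrt_sq (mul_nonneg (Real.sqrt_nonneg (2 * lam)) hu)]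
    congr 1
    rw [mul_pow, mul_pow, h2ls]
    linear_combination -2 * lam * hBD
  rw [Phi, hcos, hsin, hroot, mul_div_cancel_left₀ _ h2l, mul_div_cancel_left₀ _ h2,
    mul_div_cancel_left₀ _ h2l]

theorem stmt_10 (mA mB mC mD bA : ℝ) (hCD : mC ≠ mD)
    (U V T : Fin 9 → ℝ)
    (hU : U ∈ CIP mA mB mC mD bA) (hV : V ∈ CIP mA mB mC mD bA)
    (hT : T ∈ CIP mA mB mC mD bA)
    (hUU : pinner U U = 1) (hVV : pinner V V = 1) (hTT : pinner T T = 1)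
    (hUV : pinner U V = 0) (hUT : pinner U T = 0) (hVT : pinner V T = 0)
    (hspan : ∀ P ∈ CIP mA mB mC mD bA, ∃ u v t : ℝ, P = u • U + v • V + t • T)
    (hUAC : vAC U = (0, 0)) (hVBD : vBD V = (0, 0))
    (lam mu : ℝ) (hlam : lam = dot2 (vAC T) (vAC T)) (hmu : mu = dot2 (vBD T) (vBD T))
    (hge : mu ≤ lam) :
    {P ∈ CIP mA mB mC mD bA |
        dot2 (vAC P) (vAC P) = dot2 (vBD P) (vBD P) ∧ pinner P P = 1} =
      Phi U V T lam mu '' Set.Icc 0 (2 * π) ∪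
        (fun θ => -Phi U V T lam mu θ) '' Set.Icc 0 (2 * π) := by
  have hsum : lam + mu = 1 := by rw [hlam, hmu]; exact hTT
  have hpos : 0 < lam := by linarith
  have hAC := dot2_vAC_combination hVV hVT hUAC hVBD
  have hBD := dot2_vBD_combination hUU hUT hUAC hVBD
  rw [← hlam] at hAC
  rw [← hmu] at hBD
  have hiff : ∀ u v t : ℝ,
      u • U + v • V + t • T ∈ {P ∈ CIP mA mB mC mD bA |
        dot2 (vAC P) (vAC P) = dot2 (vBD P) (vBD P) ∧ pinner P P = 1} ↔
      v ^ 2 + t ^ 2 * lam = 1 / 2 ∧ u ^ 2 + t ^ 2 * mu = 1 / 2 := by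
    intro u v t
    simp only [Set.mem_ofPred_eq, combination_mem_CIP hU hV hT u v t, true_and, pinner, hAC, hBD]
    constructor
    · rintro ⟨h1, h2⟩
      constructor <;> linarith
    · rintro ⟨h1, h2⟩
      constructor <;> linarith
  have hneg : ∀ u v t : ℝ,
      -(u • U + v • V + t • T) = (-u) • U + (-v) • V + (-t) • T := by
    intro u v t
    module
  have hPhi : ∀ θ : ℝ,
      (Real.sin θ / √2) ^ 2 + (Real.cos θ / √(2 * lam)) ^ 2 * lam = 1 / 2 ∧
      (√(lam - mu * Real.cos θ ^ 2) / √(2 * lam)) ^ 2 + (Real.cos θ / √(2 * lam)) ^ 2 * mu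
        = 1 / 2 := by
    intro θ
    have hcs := Real.sin_sq_add_cos_sq θ
    have hrad : 0 ≤ lam - mu * Real.cos θ ^ 2 := by
      nlinarith [sq_nonneg (Real.sin θ), sq_nonneg (Real.cos θ)]
    simp only [div_pow, Real.sq_sqrt hrad, Real.sq_sqrt (show (0 : ℝ) ≤ 2 by norm_num),
      Real.sq_sqrt (show 0 ≤ 2 * lam by positivity)]
    constructor
    · field_simp
      linarith
    · field_simp
      ring
  ext P
  constructor
  · intro hP
    obtain ⟨u, v, t, rfl⟩ := hspan P hP.1
    obtain ⟨h1, h2⟩ := (hiff u v t).1 hP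
    rcases le_total 0 u with hu | hu
    · exact Or.inl (combination_mem_Phi_image U V T hpos hu h1 h2)
    · obtain ⟨θ, hθ, hEq⟩ := combination_mem_Phi_image U V T (u := -u) (v := -v) (t := -t)
        hpos (neg_nonneg.2 hu) (by rwa [neg_sq, neg_sq]) (by rwa [neg_sq, neg_sq])
      refine Or.inr ⟨θ, hθ, ?_⟩
      simp only [hEq, ← hneg, neg_neg]
  · rintro (⟨θ, -, rfl⟩ | ⟨θ, -, rfl⟩)
    · exact (hiff _ _ _).2 (hPhi θ)
    · simp only [Phi, hneg]
      rw [hiff]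
      simpa only [neg_sq] using hPhi θ
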